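/- Let h: M°π → Mπ be a Hamiltonian section of μ: Mπ → M°π with associated Hamiltonian function H, so h(x^i, u^α, p^i_α) = (x^i, u^α, -H(x^i, u^α, p^i_α), p^i_α), and Ω_h = h*Ω. A local section τ(x) = (x^i, τ^α(x), τ^i_α(x)) of M°π → M satisfies τ*(i_X Ω_h) = 0 for all vector fields X on M°π if and only if it satisfies the Hamilton–De Donder–Weyl equations ∂τ^α/∂x^i = (∂H/∂p^i_α) ∘ τ and Σ_i ∂τ^i_α/∂x^i = -(∂H/∂u^α) ∘ τ. -/

import Mathlib

open scoped BigOperators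

noncomputable section

/-- Coordinates `(xⁱ, uᵅ, pⁱᵅ)` on `M°π` (also its own tangent space). -/
abbrev MR (m n : ℕ) := (Fin (m+1) → ℝ) × (Fin n → ℝ) × (Fin (m+1) → Fin n → ℝ)

/-- The form `Ω_h = h*Ω = dH ∧ d^{m+1}x - dpⁱᵅ ∧ duᵅ ∧ dᵐx_i` on `M°π`, for the
Hamiltonian section `h(xⁱ,uᵅ,pⁱᵅ) = (xⁱ,uᵅ,-H,pⁱᵅ)`, evaluated at `q` on `m+2`
tangent vectors (each elementary wedge being the determinant of the matrix of
components, with `dᵐx_i = (-1)ⁱ dx⁰∧…∧d̂xⁱ∧…∧dxᵐ`). -/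
def OmegaH (m n : ℕ) (H : MR m n → ℝ) (q : MR m n)
    (w : Fin (m+2) → MR m n) : ℝ :=
  Matrix.det (Matrix.of fun a b =>
      Fin.cases (fderiv ℝ H q (w a)) (fun b1 => (w a).1 b1) b)
  - ∑ i : Fin (m+1), ∑ α : Fin n, (-1:ℝ)^(i:ℕ) *
      Matrix.det (Matrix.of fun a b =>
        Fin.cases ((w a).2.2 i α)
          (fun b1 => Fin.cases ((w a).2.1 α)
            (fun b2 => (w a).1 (i.succAbove b2)) b1) b)

def DD {E : Type*} [AddCommGroup E] [Module ℝ E] {k : ℕ} (L : Fin k → E →ₗ[ℝ] ℝ)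
    (w : Fin k → E) : ℝ := Matrix.det (Matrix.of fun a b => L b (w a))

lemma DD_add {E : Type*} [AddCommGroup E] [Module ℝ E] {k : ℕ} (L : Fin (k+1) → E →ₗ[ℝ] ℝ)
    (X Y : E) (w : Fin k → E) :
    DD L (Fin.cons (X + Y) w) = DD L (Fin.cons X w) + DD L (Fin.cons Y w) := by
  unfold DD
  rw [Matrix.det_succ_row_zero, Matrix.det_succ_row_zero, Matrix.det_succ_row_zero,
    ← Finset.sum_add_distrib]
  refine Finset.sum_congr rfl fun j _ => ?_
  simp only [Matrix.of_apply, Fin.cons_zero, map_add, Matrix.submatrix, Fin.cons_succ]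
  ring

lemma DD_zero {E : Type*} [AddCommGroup E] [Module ℝ E] {m : ℕ}
    (L : Fin (m+2) → E →ₗ[ℝ] ℝ) (T : (Fin (m+1) → ℝ) →ₗ[ℝ] E)
    (y : Fin (m+2) → (Fin (m+1) → ℝ)) :
    DD L (fun a => T (y a)) = 0 := by
  have hdep : ¬ LinearIndependent ℝ y := by
    intro h
    have := h.fintype_card_le_finrank
    simp at this
  rw [Fintype.not_linearIndependent_iff] at hdep
  obtain ⟨c, hc, a, ha⟩ := hdep
  unfold DD
  rw [← Matrix.exists_vecMul_eq_zero_iff]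
  refine ⟨c, fun h => ha (by rw [h]; rfl), ?_⟩
  funext b
  have := congrArg (fun z => L b (T z)) hc
  simpa [Matrix.vecMul, dotProduct] using this

lemma det_lin {m : ℕ} (l : (Fin (m+1) → ℝ) →ₗ[ℝ] ℝ) (i : Fin (m+1))
    (v : Fin (m+1) → (Fin (m+1) → ℝ)) :
    Matrix.det (Matrix.of fun a b => 
      (Fin.cons (l (v a)) (fun b2 => v a (i.succAbove b2)) : Fin (m+1) → ℝ) b)
      = (-1:ℝ)^(i:ℕ) * l (Pi.single i 1) * Matrix.det (Matrix.of v) := by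
  set N : Matrix (Fin (m+1)) (Fin (m+1)) ℝ := Matrix.of fun k b =>
    (Fin.cons (l (Pi.single k 1)) (fun b2 => if k = i.succAbove b2 then (1:ℝ) else 0)
      : Fin (m+1) → ℝ) b with hN
  have h1 : (Matrix.of fun a b => 
      (Fin.cons (l (v a)) (fun b2 => v a (i.succAbove b2)) : Fin (m+1) → ℝ) b)
      = Matrix.of v * N := by
    ext a b
    rw [Matrix.mul_apply]
    refine Fin.cases ?_ (fun b2 => ?_) b
    · simp only [hN, Matrix.of_apply, Fin.cons_zero]
      conv_lhs => rw [LinearMap.pi_apply_eq_sum_univ l (v a)]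
      refine Finset.sum_congr rfl fun k _ => ?_
      rw [smul_eq_mul]
      congr 2
      ext j
      simp [Pi.single_apply, eq_comm]
    · simp [hN]
  have h2 : N.det = (-1:ℝ)^(i:ℕ) * l (Pi.single i 1) := by
    rw [Matrix.det_succ_row N i, Fin.sum_univ_succ]
    have h3 : N.submatrix i.succAbove (Fin.succAbove 0) = 1 := by
      ext a b
      simp [hN, Matrix.one_apply]
    rw [h3]
    simp [hN, (Fin.succAbove_ne i _).symm]
  rw [h1, Matrix.det_mul, h2]
  ring

def L1 {m n : ℕ} (G : MR m n →ₗ[ℝ] ℝ) : Fin (m+2) → MR m n →ₗ[ℝ] ℝ :=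
  Fin.cons G (fun b => LinearMap.proj b ∘ₗ LinearMap.fst ℝ _ _)

def L2 {m n : ℕ} (i : Fin (m+1)) (α : Fin n) : Fin (m+2) → MR m n →ₗ[ℝ] ℝ :=
  Fin.cons (LinearMap.proj α ∘ₗ LinearMap.proj i ∘ₗ LinearMap.snd ℝ _ _ ∘ₗ LinearMap.snd ℝ _ _)
    (Fin.cons (LinearMap.proj α ∘ₗ LinearMap.fst ℝ _ _ ∘ₗ LinearMap.snd ℝ _ _)
      (fun b => LinearMap.proj (i.succAbove b) ∘ₗ LinearMap.fst ℝ _ _))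

lemma OmegaH_eq (m n : ℕ) (H : MR m n → ℝ) (q : MR m n) (w : Fin (m+2) → MR m n) :
    OmegaH m n H q w = DD (L1 (fderiv ℝ H q : MR m n →ₗ[ℝ] ℝ)) w
      - ∑ i : Fin (m+1), ∑ α : Fin n, (-1:ℝ)^(i:ℕ) * DD (L2 i α) w := by
  unfold OmegaH DD
  congr 1
  · congr 2
    funext a b
    refine Fin.cases ?_ (fun b => ?_) b <;> simp [L1]
  · refine Finset.sum_congr rfl fun i _ => Finset.sum_congr rfl fun α _ => ?_
    congr 3
    funext a b
    refine Fin.cases ?_ (fun b => Fin.cases ?_ (fun b => ?_) b) b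
    · simp [L2]
    · simp only [L2, Fin.cons_succ, Fin.cons_zero]
      rfl
    · simp [L2]

lemma DD_L1 {m n : ℕ} (G : MR m n →ₗ[ℝ] ℝ) (Y) (w : Fin (m+1) → MR m n) :
    DD (L1 G) (Fin.cons ((0, Y) : MR m n) w) =
      G (0, Y) * Matrix.det (Matrix.of fun a => (w a).1) := by
  unfold DD
  rw [Matrix.det_succ_row_zero, Fin.sum_univ_succ]
  have : ((Matrix.of fun a b => (L1 G b) ((Fin.cons ((0, Y) : MR m n) w : Fin (m+2) → MR m n) a)).submatrix
      Fin.succ (Fin.succAbove 0)) = Matrix.of fun a => (w a).1 := by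
    ext a b
    simp [L1]
  rw [this]
  simp [L1]

lemma DD_L2 {m n : ℕ} (i : Fin (m+1)) (α : Fin n) (Y : (Fin n → ℝ) × (Fin (m+1) → Fin n → ℝ))
    (D : (Fin (m+1) → ℝ) →ₗ[ℝ] (Fin n → ℝ) × (Fin (m+1) → Fin n → ℝ))
    (v : Fin (m+1) → (Fin (m+1) → ℝ)) :
    DD (L2 i α) (Fin.cons ((0, Y) : MR m n) (fun j => ((v j, D (v j)) : MR m n))) =
      (-1:ℝ)^(i:ℕ) * (Y.2 i α * (D (Pi.single i 1)).1 α - Y.1 α * (D (Pi.single i 1)).2 i α)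
        * Matrix.det (Matrix.of v) := by
  have e1 := det_lin (LinearMap.proj α ∘ₗ LinearMap.fst ℝ _ _ ∘ₗ D) i v
  have e2 := det_lin (LinearMap.proj α ∘ₗ LinearMap.proj i ∘ₗ LinearMap.snd ℝ _ _ ∘ₗ D) i v
  unfold DD
  rw [Matrix.det_succ_row_zero, Fin.sum_univ_succ, Fin.sum_univ_succ]
  set M := (Matrix.of fun a b => (L2 i α b) ((Fin.cons ((0, Y) : MR m n)
    (fun j => ((v j, D (v j)) : MR m n)) : Fin (m+2) → MR m n) a)) with hM
  have s1 : M.submatrix Fin.succ (Fin.succAbove 0) = Matrix.of fun a b => 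
      (Fin.cons ((LinearMap.proj α ∘ₗ LinearMap.fst ℝ _ _ ∘ₗ D) (v a))
        (fun b2 => v a (i.succAbove b2)) : Fin (m+1) → ℝ) b := by
    ext a b
    refine Fin.cases ?_ (fun b => ?_) b <;> simp [hM, L2]
  have s2 : M.submatrix Fin.succ (Fin.succAbove (Fin.succ 0)) = Matrix.of fun a b => 
      (Fin.cons ((LinearMap.proj α ∘ₗ LinearMap.proj i ∘ₗ LinearMap.snd ℝ _ _ ∘ₗ D) (v a))
        (fun b2 => v a (i.succAbove b2)) : Fin (m+1) → ℝ) b := by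
    ext a b
    refine Fin.cases ?_ (fun b => ?_) b
    · simp [hM, L2]
    · simp only [Matrix.submatrix_apply, Fin.succ_succAbove_succ, Fin.zero_succAbove]
      simp [hM, L2]
  rw [s1, s2, e1, e2]
  have z : ∀ b : Fin m, M 0 b.succ.succ = 0 := fun b => by simp [hM, L2]
  have z0 : M 0 0 = Y.2 i α := by simp [hM, L2]
  have z1 : M 0 (Fin.succ 0) = Y.1 α := by simp only [hM, L2, Matrix.of_apply, Fin.cons_succ, Fin.cons_zero]; simp
  rw [z0, z1]
  simp only [z]
  simp
  ring

lemma key (m n : ℕ) (H : MR m n → ℝ) (q : MR m n) (X : MR m n)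
    (D : (Fin (m+1) → ℝ) →L[ℝ] (Fin n → ℝ) × (Fin (m+1) → Fin n → ℝ))
    (v : Fin (m+1) → (Fin (m+1) → ℝ)) :
    OmegaH m n H q (Fin.cons X (fun j => ((v j, D (v j)) : MR m n))) =
      (fderiv ℝ H q (0, X.2 - D X.1) - ∑ i : Fin (m+1), ∑ α : Fin n,
        ((X.2 - D X.1).2 i α * (D (Pi.single i 1)).1 α
          - (X.2 - D X.1).1 α * (D (Pi.single i 1)).2 i α)) * Matrix.det (Matrix.of v) := by
  set Y := X.2 - D X.1 with hY
  set T : (Fin (m+1) → ℝ) →ₗ[ℝ] MR m n := LinearMap.prod LinearMap.id (D : _ →ₗ[ℝ] _) with hT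
  have hX : X = ((0, Y) : MR m n) + T X.1 := by
    ext <;> simp [hY, hT]
  have red : ∀ L : Fin (m+2) → MR m n →ₗ[ℝ] ℝ,
      DD L (Fin.cons X (fun j => ((v j, D (v j)) : MR m n))) =
      DD L (Fin.cons ((0, Y) : MR m n) (fun j => ((v j, D (v j)) : MR m n))) := by
    intro L
    have h0 := DD_zero L T (Fin.cons X.1 v)
    have h1 : (fun a => T ((Fin.cons X.1 v : Fin (m+2) → (Fin (m+1) → ℝ)) a)) =
        Fin.cons (T X.1) (fun j => ((v j, D (v j)) : MR m n)) := by
      funext a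
      refine Fin.cases ?_ (fun b => ?_) a <;> simp [hT]
    rw [h1] at h0
    conv_lhs => rw [hX]
    rw [DD_add, h0, add_zero]
  rw [OmegaH_eq]
  simp only [red, DD_L1]
  have e2 := fun i α => DD_L2 (m := m) (n := n) i α Y (D : _ →ₗ[ℝ] _) v
  simp only [ContinuousLinearMap.coe_coe] at e2 ⊢
  simp only [e2]
  rw [sub_mul, Finset.sum_mul]
  congr 1
  refine Finset.sum_congr rfl fun i _ => ?_
  rw [Finset.sum_mul]
  refine Finset.sum_congr rfl fun α _ => ?_
  rw [← mul_assoc, ← mul_assoc, ← mul_pow]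
  simp

lemma expand {m n : ℕ} (G : MR m n →L[ℝ] ℝ) (Y : (Fin n → ℝ) × (Fin (m+1) → Fin n → ℝ)) :
    G (0, Y) = (∑ α, Y.1 α * G (0, Pi.single α 1, 0)) +
      ∑ i, ∑ α, Y.2 i α * G (0, 0, Pi.single i (Pi.single α 1)) := by
  have h : ((0, Y) : MR m n) = (∑ α, Y.1 α • ((0, Pi.single α 1, 0) : MR m n)) +
      ∑ i, ∑ α, Y.2 i α • ((0, 0, Pi.single i (Pi.single α 1)) : MR m n) := by
    ext a b
    · simp [Prod.fst_sum]
    · simp [Prod.fst_sum, Prod.snd_sum, Finset.sum_apply, Pi.single_apply]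
    · simp only [Prod.snd_add, Prod.snd_sum, Prod.smul_snd, Pi.add_apply, Finset.sum_apply,
        Pi.smul_apply, smul_eq_mul, Pi.zero_apply, mul_zero, Finset.sum_const_zero, zero_add]
      rw [Finset.sum_eq_single a]
      · simp [Pi.single_apply]
      · intro c _ hc
        simp [hc.symm]
      · simp
  rw [h]
  simp only [map_add, map_sum, map_smul, smul_eq_mul]

/-- a section `τ(x) = (x, τᵅ(x), τⁱᵅ(x))` of `M°π → M` satisfies
`τ*(i_X Ω_h) = 0` for all vector fields `X` iff it satisfies the
Hamilton–De Donder–Weyl equations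
`∂τᵅ/∂xⁱ = (∂H/∂pⁱᵅ)∘τ` and `∑ᵢ ∂τⁱᵅ/∂xⁱ = -(∂H/∂uᵅ)∘τ`. -/
theorem stmt17 (m n : ℕ) (H : MR m n → ℝ) (hH : ContDiff ℝ (⊤ : ℕ∞) H)
    (τ : (Fin (m+1) → ℝ) → (Fin n → ℝ) × (Fin (m+1) → Fin n → ℝ))
    (hτ : Differentiable ℝ τ) :
    (∀ (x : Fin (m+1) → ℝ) (X : MR m n)
        (v : Fin (m+1) → (Fin (m+1) → ℝ)),
      OmegaH m n H (x, τ x)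
        (Fin.cons X (fun j => ((v j, fderiv ℝ τ x (v j)) : MR m n))) = 0) ↔
    ((∀ (x : Fin (m+1) → ℝ) (i : Fin (m+1)) (α : Fin n),
        fderiv ℝ (fun x' => (τ x').1 α) x (Pi.single i 1) =
          fderiv ℝ H (x, τ x) (0, 0, Pi.single i (Pi.single α 1))) ∧
     (∀ (x : Fin (m+1) → ℝ) (α : Fin n),
        (∑ i : Fin (m+1),
          fderiv ℝ (fun x' => (τ x').2 i α) x (Pi.single i 1)) =
          - fderiv ℝ H (x, τ x) (0, Pi.single α 1, 0))) := by
  have c1 : ∀ x v α, fderiv ℝ (fun x' => (τ x').1 α) x v = (fderiv ℝ τ x v).1 α := by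
    intro x v α
    have := (((ContinuousLinearMap.proj (R := ℝ) (φ := fun _ : Fin n => ℝ) α).comp
      (ContinuousLinearMap.fst ℝ (Fin n → ℝ) (Fin (m+1) → Fin n → ℝ))).hasFDerivAt.comp x
        (hτ x).hasFDerivAt).fderiv
    exact congrArg (fun l => l v) this
  have c2 : ∀ x v i α, fderiv ℝ (fun x' => (τ x').2 i α) x v = (fderiv ℝ τ x v).2 i α := by
    intro x v i α
    have := (((ContinuousLinearMap.proj (R := ℝ) (φ := fun _ : Fin n => ℝ) α).comp
      ((ContinuousLinearMap.proj (R := ℝ) (φ := fun _ : Fin (m+1) => Fin n → ℝ) i).comp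
      (ContinuousLinearMap.snd ℝ (Fin n → ℝ) (Fin (m+1) → Fin n → ℝ)))).hasFDerivAt.comp x
        (hτ x).hasFDerivAt).fderiv
    exact congrArg (fun l => l v) this
  simp only [c1, c2, key]
  constructor
  · intro h
    have hd : Matrix.det (Matrix.of (fun i : Fin (m+1) => (Pi.single i 1 : Fin (m+1) → ℝ))) = 1 := by
      rw [← Matrix.det_one (n := Fin (m+1)) (R := ℝ)]
      congr 1
      ext i j
      simp [Matrix.one_apply, Pi.single_apply, eq_comm]
    constructor
    · intro x i α
      have := h x (0, 0, Pi.single i (Pi.single α 1)) (fun i => Pi.single i 1)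
      rw [hd, mul_one, Finset.sum_eq_single i, Finset.sum_eq_single α] at this
      · simp at this
        linarith
      · intro b _ hb
        simp [hb]
      · simp
      · intro b _ hb
        simp [hb]
      · simp
    · intro x α
      have := h x (0, Pi.single α 1, 0) (fun i => Pi.single i 1)
      rw [hd, mul_one, Finset.sum_comm, Finset.sum_eq_single α] at this
      · simp at this
        linarith
      · intro b _ hb
        simp [hb]
      · simp
  · rintro ⟨h1, h2⟩ x X v
    rw [expand]
    simp only [← h1, Finset.sum_sub_distrib]
    rw [Finset.sum_comm (f := fun i α => (X.2 - (fderiv ℝ τ x) X.1).1 α * _)]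
    simp only [← Finset.mul_sum, h2]
    simp only [mul_neg, Finset.sum_neg_distrib]
    ring

end
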